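/- (Appendix bilinear equation bl7.) Suppose ψ satisfies the contiguous relations (re1)–(re4), and fix nonzero t, b₁, b₃ ∈ ℂ such that qʲ·b₁ ≠ 1, qʲ·t·b₁ ≠ 1 and qʲ·b₃ ≠ 1 for every integer j. Then for every integer N ≥ 0: τ_N^{−1,1}(qt)·τ_{N+1}^{0,1}(t/q) + t·(1 − q^{−N}·b₁)·τ_N^{0,1}(t)·τ_{N+1}^{−1,1}(t) − τ_N^{−1,2}(t)·τ_{N+1}^{0,0}(t) = 0. -/

import Mathlib

open Finset in
lemma core_sum (N : ℕ) (q c t y0 : ℂ) (hq : q ≠ 0) (hc : c ≠ 0) (h G Q : ℕ → ℂ) (l : Fin (N+1) → ℂ)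
    (hG : ∀ i, G i = h i + c * h (i+1)) (hQ : ∀ i, Q i = h i + t * h (i+1))
    (hP : ∀ i, y0 * q ^ i * G i = Q i + Q (i+1))
    (hl : ∀ i, 1 ≤ i → i ≤ N → ∑ k, l k * G (i + k) = 0) :
    (∑ k : Fin (N+1), l k * (-1) ^ (k:ℕ)) * (∑ k : Fin (N+1), l k * ((q⁻¹) ^ (k:ℕ) * Q (k+1)))
      + (t - c) * (∑ k : Fin (N+1), l k * (-(q * c)⁻¹) ^ (k:ℕ)) * (∑ k : Fin (N+1), l k * h (k+1))
      + (1 - y0) * l 0 * (∑ k : Fin (N+1), l k * G k) = 0 := by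
  have hqk : ∀ k : ℕ, (q⁻¹) ^ k * q ^ k = 1 := by
    intro k; rw [← mul_pow, inv_mul_cancel₀ hq, one_pow]
  -- D
  have hD : ∀ i, i ≤ N → ∑ k : Fin (N+1), l k * ((q⁻¹) ^ (k:ℕ) * Q (k+1+i))
      = (-1)^i * ∑ k : Fin (N+1), l k * ((q⁻¹) ^ (k:ℕ) * Q (k+1)) := by
    intro i
    induction i with
    | zero => intro _; simp
    | succ i ih =>
      intro hi
      have h1 := ih (by omega)
      have h2 := hl (i+1) (by omega) hi
      have h3 : ∑ k : Fin (N+1), l k * ((q⁻¹) ^ (k:ℕ) * Q (k+1+i))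
          + ∑ k : Fin (N+1), l k * ((q⁻¹) ^ (k:ℕ) * Q (k+1+(i+1)))
          = y0 * q^(i+1) * ∑ k : Fin (N+1), l k * G (i+1+k) := by
        rw [← sum_add_distrib, mul_sum]
        refine sum_congr rfl fun k _ => ?_
        have := hP (k+1+i)
        have e : i + 1 + (k:ℕ) = k+1+i := by omega
        rw [e, ← add_assoc]
        have hk := hqk k
        rw [show (k:ℕ)+1+i = k + (i+1) by omega, pow_add] at *
        linear_combination (-(l k * q⁻¹^(k:ℕ))) * this + (l k * y0 * q^(i+1) * G (k+(i+1))) * hk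
      rw [h2, h1] at h3
      rw [pow_succ]
      linear_combination h3
  have hF : ∀ i, i ≤ N → ∑ k : Fin (N+1), l k * h (k+1+i)
      = (-c⁻¹)^i * ∑ k : Fin (N+1), l k * h (k+1) := by
    intro i
    induction i with
    | zero => intro _; simp
    | succ i ih =>
      intro hi
      have h1 := ih (by omega)
      have h2 := hl (i+1) (by omega) hi
      have h3 : ∑ k : Fin (N+1), l k * h (k+1+i)
          + c * ∑ k : Fin (N+1), l k * h (k+1+(i+1))
          = ∑ k : Fin (N+1), l k * G (i+1+k) := by
        rw [mul_sum, ← sum_add_distrib]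
        refine sum_congr rfl fun k _ => ?_
        rw [hG, show i + 1 + (k:ℕ) = k+1+i by omega, ← add_assoc]
        ring
      rw [h2, h1] at h3
      rw [pow_succ]
      have : c⁻¹ * c = 1 := inv_mul_cancel₀ hc
      linear_combination c⁻¹ * h3 - (∑ k : Fin (N+1), l k * h (k+1+(i+1))) * this
  have hA : ∀ s : ℕ → ℂ, s 0 = 1 → ∑ j : Fin (N+1), ∑ k : Fin (N+1), l j * s j * (l k * G (j + k))
      = l 0 * ∑ k : Fin (N+1), l k * G k := by
    intro s hs
    rw [Fin.sum_univ_succ]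
    have : ∀ j : Fin N, ∑ k : Fin (N+1), l j.succ * s (j.succ : Fin (N+1)) * (l k * G ((j.succ : Fin (N+1)) + k)) = 0 := by
      intro j
      rw [← mul_sum, hl _ (by simp) (by simp), mul_zero]
    simp only [this, sum_const_zero, add_zero]
    rw [← mul_sum]
    simp [hs]
  have e1 : (∑ k : Fin (N+1), l k * (-1) ^ (k:ℕ)) * (∑ k : Fin (N+1), l k * ((q⁻¹) ^ (k:ℕ) * Q (k+1)))
      = ∑ j : Fin (N+1), ∑ k : Fin (N+1), l j * l k * q⁻¹^(j:ℕ) * Q (j+k+1) := by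
    rw [sum_mul, sum_comm]
    refine sum_congr rfl fun k _ => ?_
    rw [mul_assoc, ← hD k (by omega), mul_sum]
    refine sum_congr rfl fun j _ => ?_
    rw [show (j:ℕ)+1+k = j+k+1 by omega]; ring
  have e2 : (∑ k : Fin (N+1), l k * (-(q * c)⁻¹) ^ (k:ℕ)) * (∑ k : Fin (N+1), l k * h (k+1))
      = ∑ j : Fin (N+1), ∑ k : Fin (N+1), l j * l k * q⁻¹^(j:ℕ) * h (j+k+1) := by
    rw [sum_mul]
    refine sum_congr rfl fun j _ => ?_
    have : (-(q * c)⁻¹) ^ (j:ℕ) = q⁻¹^(j:ℕ) * (-c⁻¹)^(j:ℕ) := by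
      rw [← mul_pow, mul_inv]; ring
    rw [this, ← mul_assoc, mul_assoc, ← hF j (by omega), mul_sum]
    refine sum_congr rfl fun k _ => ?_
    rw [show (k:ℕ)+1+j = j+k+1 by omega]; ring
  have e3 := hA (fun j => q⁻¹^j) (by simp)
  have e4 := hA (fun j => q^j) (by simp)
  have e5 : y0 * ∑ j : Fin (N+1), ∑ k : Fin (N+1), l j * q^(j:ℕ) * (l k * G (j + k))
      = ∑ j : Fin (N+1), ∑ k : Fin (N+1), l j * l k * q⁻¹^(j:ℕ) * (Q (j+k) + Q (j+k+1)) := by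
    rw [sum_comm, mul_sum]
    refine sum_congr rfl fun j _ => ?_
    rw [mul_sum]
    refine sum_congr rfl fun k _ => ?_
    rw [← hP, show (k:ℕ)+j = j+k by omega, pow_add]
    linear_combination (-(l k * l j * q^(k:ℕ) * G (j+k) * y0)) * hqk j
  have : (∑ j : Fin (N+1), ∑ k : Fin (N+1), l j * l k * q⁻¹^(j:ℕ) * Q (j+k+1))
      + (t - c) * (∑ j : Fin (N+1), ∑ k : Fin (N+1), l j * l k * q⁻¹^(j:ℕ) * h (j+k+1))
      + (∑ j : Fin (N+1), ∑ k : Fin (N+1), l j * q⁻¹^(j:ℕ) * (l k * G (j + k)))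
      - (∑ j : Fin (N+1), ∑ k : Fin (N+1), l j * l k * q⁻¹^(j:ℕ) * (Q (j+k) + Q (j+k+1))) = 0 := by
    rw [mul_sum, ← sum_add_distrib, ← sum_add_distrib, ← sum_sub_distrib]
    refine sum_eq_zero fun j _ => ?_
    rw [mul_sum, ← sum_add_distrib, ← sum_add_distrib, ← sum_sub_distrib]
    refine sum_eq_zero fun k _ => ?_
    rw [hG, hQ (j+k)]; ring
  linear_combination e1 + (t-c)*e2 + this - e3 + y0 * e4 - e5

/-- bordered Hankel matrix -/
noncomputable def bM (N : ℕ) (G : ℕ → ℂ) (X : ℕ → ℂ) : Matrix (Fin (N+1)) (Fin (N+1)) ℂ :=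
  Matrix.of (Fin.cons (fun k : Fin (N+1) => X k) (fun (i : Fin N) (k : Fin (N+1)) => G (i + 1 + k)))

/-- cofactors -/
noncomputable def cof (N : ℕ) (G : ℕ → ℂ) (k : Fin (N+1)) : ℂ :=
  (-1) ^ (k:ℕ) * Matrix.det (Matrix.of fun (i : Fin N) (j : Fin N) => G (i + 1 + (k.succAbove j : Fin (N+1))))

lemma det_bM (N : ℕ) (G X : ℕ → ℂ) : (bM N G X).det = ∑ k : Fin (N+1), cof N G k * X k := by
  rw [Matrix.det_succ_row_zero]
  refine Finset.sum_congr rfl fun k _ => ?_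
  have : (bM N G X).submatrix Fin.succ k.succAbove
    = (Matrix.of fun (i : Fin N) (j : Fin N) => G (i + 1 + (k.succAbove j : Fin (N+1)))) := by
    ext i j; simp [bM]
  rw [this, cof]
  simp [bM]; ring

lemma cof_orth (N : ℕ) (G : ℕ → ℂ) (i : ℕ) (h1 : 1 ≤ i) (h2 : i ≤ N) :
    ∑ k : Fin (N+1), cof N G k * G (i + k) = 0 := by
  rw [← det_bM N G (fun k => G (i + k))]
  obtain ⟨m, rfl⟩ : ∃ m, i = m + 1 := ⟨i - 1, by omega⟩
  refine Matrix.det_zero_of_row_eq (i := 0) (j := Fin.succ ⟨m, by omega⟩) (Fin.succ_ne_zero _).symm ?_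
  ext k
  simp only [bM, Matrix.of_apply, Fin.cons_zero, Fin.cons_succ]

lemma det_shift (N : ℕ) (G : ℕ → ℂ) (s : ℂ) (hs : s ≠ 0) :
    Matrix.det (Matrix.of fun i k : Fin N => G (i + k + 1) + s * G (i + k + 2))
      = s ^ N * ∑ k : Fin (N+1), cof N G k * (-s⁻¹) ^ (k:ℕ) := by
  rw [← det_bM N G (fun k => (-s⁻¹) ^ k)]
  have := Matrix.det_eq_of_forall_col_eq_smul_add_pred (A := bM N G (fun k => (-s⁻¹) ^ k))
    (B := Matrix.of (Fin.cons (fun k : Fin (N+1) => if k = 0 then 1 else 0)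
      (fun (i : Fin N) => Fin.cons (G (i+1)) (fun k : Fin N => s⁻¹ * (G (i + k + 1) + s * G (i + k + 2))))))
    (fun _ => -s⁻¹) ?_ ?_
  · rw [this, Matrix.det_succ_row_zero, Fin.sum_univ_succ]
    simp only [Matrix.of_apply, Fin.cons_zero, Fin.succ_ne_zero, if_false, if_true, mul_zero, zero_mul,
      Finset.sum_const_zero, add_zero]
    have e : (Matrix.of (Fin.cons (fun k : Fin (N+1) => if k = 0 then (1:ℂ) else 0)
      (fun (i : Fin N) => Fin.cons (G (i+1)) (fun k : Fin N => s⁻¹ * (G (i + k + 1) + s * G (i + k + 2)))))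
        : Matrix (Fin (N+1)) (Fin (N+1)) ℂ).submatrix
        Fin.succ (Fin.succAbove 0) = s⁻¹ • (Matrix.of fun i k : Fin N => G (i + k + 1) + s * G (i + k + 2)) := by
      ext i j; simp
    rw [e, Matrix.det_smul]
    simp
    field_simp
  · intro i
    refine Fin.cases ?_ (fun i => ?_) i <;> simp [bM]
  · intro i j
    refine Fin.cases ?_ (fun i => ?_) i
    · simp [bM, pow_succ]; ring
    · simp [bM]
      rw [show (i:ℕ) + 1 + (j+1) = i+j+2 by omega, show (i:ℕ) + 1 + j = i+j+1 by omega]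
      field_simp; ring

/-- generic row reduction of a Hankel determinant -/
lemma det_row (N : ℕ) (v G X : ℕ → ℂ) (a b : ℂ) (d e : ℕ → ℂ)
    (h0 : ∀ k, v (k+1) = e k * X k)
    (hv : ∀ i k, v (i + 1 + k + 1) = e k * (a * d i * G (i + 1 + k)) + b * v (i + k + 1)) :
    Matrix.det (Matrix.of fun i k : Fin (N+1) => v (i + k + 1))
      = (∏ k : Fin (N+1), e k) * (a ^ N * ∏ i : Fin N, d i) * (bM N G X).det := by
  rw [Matrix.det_eq_of_forall_row_eq_smul_add_pred (B := Matrix.of fun i k => e (k : Fin (N+1)) *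
    (Matrix.of fun i k => (Fin.cons 1 (fun i : Fin N => a * d i) : Fin (N+1) → ℂ) i * bM N G X i k) i k) (fun _ => b)]
  · rw [Matrix.det_mul_row, Matrix.det_mul_column, Fin.prod_univ_succ]
    simp [Finset.prod_mul_distrib]; ring
  · intro j; simp [bM, h0]
  · intro i j
    simp [bM]
    rw [hv]


/-- coefficients of `∏ (1 + α_d X)` -/
noncomputable def cf (α : ℕ → ℂ) : ℕ → ℕ → ℂ
  | 0, 0 => 1
  | 0, (_+1) => 0
  | (d+1), 0 => cf α d 0
  | (d+1), (k+1) => cf α d (k+1) + α d * cf α d k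

lemma cf_zero (α : ℕ → ℂ) (d k : ℕ) (h : d < k) : cf α d k = 0 := by
  induction d generalizing k with
  | zero => obtain ⟨m, rfl⟩ : ∃ m, k = m + 1 := ⟨k - 1, by omega⟩
            simp [cf]
  | succ d ih =>
    obtain ⟨m, rfl⟩ : ∃ m, k = m + 1 := ⟨k - 1, by omega⟩
    simp [cf, ih (m+1) (by omega), ih m (by omega)]

lemma cf_scale (α : ℕ → ℂ) (s : ℂ) (d k : ℕ) : cf (fun i => s * α i) d k = s ^ k * cf α d k := by
  induction d generalizing k with
  | zero => cases k <;> simp [cf]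
  | succ d ih =>
    cases k with
    | zero => simp [cf, ih]
    | succ k => simp only [cf, ih]; ring

lemma cf_sum (α : ℕ → ℂ) (w : ℕ → ℕ → ℂ) (hw : ∀ d i, w (d+1) i = w d i + α d * w d (i+1))
    (d M i : ℕ) (h : d < M) : w d i = ∑ k ∈ Finset.range M, cf α d k * w 0 (i + k) := by
  induction d generalizing i with
  | zero =>
    obtain ⟨m, rfl⟩ : ∃ m, M = m + 1 := ⟨M - 1, by omega⟩
    rw [Finset.sum_range_succ']
    simp [cf]
  | succ d ih =>
    rw [hw, ih i (by omega), ih (i+1) (by omega)]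
    obtain ⟨m, rfl⟩ : ∃ m, M = m + 1 := ⟨M - 1, by omega⟩
    rw [Finset.sum_range_succ', Finset.sum_range_succ, Finset.sum_range_succ' _ m, cf_zero α d m (by omega)]
    simp only [cf, add_mul, Finset.sum_add_distrib, mul_add, Finset.mul_sum]
    have : ∀ k, α d * (cf α d k * w 0 (i + 1 + k)) = α d * cf α d k * w 0 (i + (k+1)) := by
      intro k; rw [show i + 1 + k = i + (k+1) by omega]; ring
    simp only [this]
    ring

/-- the constant -/
noncomputable def kap (q a : ℂ) (n : ℕ) : ℂ :=
  Matrix.det (Matrix.of fun k j : Fin n => cf (fun d => a * q ^ (-((n:ℤ) - 1 - d))) (n - 1 - j) k)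

lemma kap_scale (q a s : ℂ) (n : ℕ) : kap q (s * a) n = (∏ k : Fin n, s ^ (k:ℕ)) * kap q a n := by
  unfold kap
  rw [← Matrix.det_mul_column]
  congr 1
  ext k j
  simp only [Matrix.of_apply, mul_assoc]
  rw [cf_scale]

lemma hankelize (q a : ℂ) (hq : q ≠ 0) (n r : ℕ) (m : ℤ) (u : ℤ → ℕ → ℂ)
    (hu : ∀ j i, u (j - 1) i = u j i + a * q ^ (-j) * u j (i+1)) :
    Matrix.det (Matrix.of fun i j : Fin n => u (j - m) (i + r))
      = kap q (a * q ^ m) n * Matrix.det (Matrix.of fun i k : Fin n => u (n - 1 - m) (i + k + r)) := by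
  rw [mul_comm, kap, ← Matrix.det_mul]
  congr 1
  ext i j
  rw [Matrix.mul_apply]
  simp only [Matrix.of_apply]
  have := cf_sum (fun d => (a * q ^ m) * q ^ (-((n:ℤ) - 1 - d))) (fun d i => u (n - 1 - m - d) i)
    (by
      intro d i
      have := hu (n - 1 - m - d) i
      push_cast
      rw [← sub_sub, this, mul_assoc a (q ^ m), ← zpow_add₀ hq,
        show m + -((n:ℤ) - 1 - d) = -(n - 1 - m - d) by ring]) (n - 1 - j) n (i + r) (by omega)
  rw [← Fin.sum_univ_eq_sum_range (fun k => cf (fun d => (a * q ^ m) * q ^ (-((n:ℤ) - 1 - d))) (n-1-j) k *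
    u (n - 1 - m - (0:ℕ)) (i + r + k))] at this
  have e : (n:ℤ) - 1 - m - ((n - 1 - j : ℕ) : ℤ) = j - m := by omega
  rw [e] at this
  rw [this]
  refine Finset.sum_congr rfl fun k _ => ?_
  rw [mul_comm, show (i:ℕ) + r + k = i + k + r by omega]
  simp



/-- `τ_N(t,b₁,b₃) = det(ψ(t, q^{1-j} b₁, q^{i-1} b₃))_{i,j=1,…,N}` (and `τ₀ = 1`,
which is the determinant of the empty matrix). -/
noncomputable def tau (q : ℂ) (ψ : ℂ → ℂ → ℂ → ℂ) (N : ℕ) (t b1 b3 : ℂ) : ℂ :=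
  Matrix.det (Matrix.of fun i j : Fin N => ψ t (q ^ (-(j : ℤ)) * b1) (q ^ (i : ℤ) * b3))

/-- `τ_N^{m,n}(t) = τ_N(t, qᵐ b₁, qⁿ b₃)`. -/
noncomputable def tauS (q : ℂ) (ψ : ℂ → ℂ → ℂ → ℂ) (N : ℕ) (m n : ℤ) (t b1 b3 : ℂ) : ℂ :=
  tau q ψ N t (q ^ m * b1) (q ^ n * b3)

theorem bilinear_bl7 (q : ℂ) (hq : q ≠ 0) (ψ : ℂ → ℂ → ℂ → ℂ)
    (hre1 : ∀ t b1 b3 : ℂ, t ≠ 0 → b1 ≠ 0 → b3 ≠ 0 →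
      ψ (q * t) b1 b3 = b1 * ψ t b1 b3 + (1 - b1) * ψ (q * t) (b1 / q) b3)
    (hre2 : ∀ t b1 b3 : ℂ, t ≠ 0 → b1 ≠ 0 → b3 ≠ 0 →
      b3 * ψ (q * t) b1 b3 = ψ t b1 b3 + (b3 - 1) * ψ t b1 (q * b3))
    (hre3 : ∀ t b1 b3 : ℂ, t ≠ 0 → b1 ≠ 0 → b3 ≠ 0 →
      q * t * b1 * b3 * ψ (q * t) b1 b3 = (q * t * b1 - 1) * ψ t b1 b3 + ψ t (q * b1) b3)
    (hre4 : ∀ t b1 b3 : ℂ, t ≠ 0 → b1 ≠ 0 → b3 ≠ 0 →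
      q * t * ψ (q * t) b1 b3 = (q * t * b1 - 1) * ψ t b1 b3 + ψ (q * t) b1 (b3 / q))
    (t b1 b3 : ℂ) (ht : t ≠ 0) (hb1 : b1 ≠ 0) (hb3 : b3 ≠ 0)
    (hgen1 : ∀ j : ℤ, q ^ j * b1 ≠ 1)
    (hgen2 : ∀ j : ℤ, q ^ j * t * b1 ≠ 1)
    (hgen3 : ∀ j : ℤ, q ^ j * b3 ≠ 1) :
    ∀ N : ℕ,
      tauS q ψ N (-1) 1 (q * t) b1 b3 * tauS q ψ (N + 1) 0 1 (t / q) b1 b3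
        + t * (1 - q ^ (-(N : ℤ)) * b1) * tauS q ψ N 0 1 t b1 b3 * tauS q ψ (N + 1) (-1) 1 t b1 b3
        - tauS q ψ N (-1) 2 t b1 b3 * tauS q ψ (N + 1) 0 0 t b1 b3 = 0 := by
  intro N
  set Γ : ℕ → ℂ := fun i => ∏ l ∈ Finset.range i, (q ^ l * b3 - 1) with hΓ
  have hΓs : ∀ i, Γ (i+1) = (q ^ i * b3 - 1) * Γ i := by
    intro i; simp only [hΓ]; rw [Finset.prod_range_succ]; ring
  have hΓ0 : Γ 0 = 1 := by simp [hΓ]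
  have hΓ1 : Γ 1 = b3 - 1 := by simp [hΓ]
  have hΓne : ∀ i, Γ i ≠ 0 := by
    intro i
    refine Finset.prod_ne_zero_iff.mpr fun l _ => sub_ne_zero.mpr ?_
    have := hgen3 l
    rwa [zpow_natCast] at this
  set g : ℂ → ℤ → ℕ → ℂ := fun s j i => Γ i * ψ s (q ^ (-j) * b1) (q ^ i * b3) with hg
  have hx : ∀ j : ℤ, q ^ (-j) * b1 ≠ 0 := fun j => mul_ne_zero (zpow_ne_zero _ hq) hb1
  have hy : ∀ i : ℕ, q ^ i * b3 ≠ 0 := fun j => mul_ne_zero (pow_ne_zero _ hq) hb3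
  have hxm : ∀ j : ℤ, q ^ (-(j-1)) * b1 = q * (q ^ (-j) * b1) := by
    intro j; rw [show -(j-1) = -j + 1 by ring, zpow_add₀ hq, zpow_one]; ring
  have hyp : ∀ i : ℕ, q ^ (i+1) * b3 = q * (q ^ i * b3) := by
    intro j; rw [pow_succ]; ring
  have R1 : ∀ s, s ≠ 0 → ∀ j i, g s (j-1) i = g s j i + q * s * b1 * q ^ (-j) * g s j (i+1) := by
    intro s hs j i
    simp only [hg, hxm, hyp, hΓs]
    have e2 := hre2 s _ _ hs (hx j) (hy i)
    have e3 := hre3 s _ _ hs (hx j) (hy i)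
    linear_combination (q * s * (q ^ (-j) * b1) * Γ i) * e2 - Γ i * e3
  have R2 : ∀ s, s ≠ 0 → ∀ j i, b3 * q ^ i * g (q * s) j i = g s j i + g s j (i+1) := by
    intro s hs j i
    simp only [hg, hyp, hΓs]
    have e2 := hre2 s _ _ hs (hx j) (hy i)
    linear_combination Γ i * e2
  have htq : t / q ≠ 0 := div_ne_zero ht hq
  have hqt : q * (t / q) = t := by field_simp
  have R3 : ∀ i, g (t/q) N i = g t (N+1) i + t * g t (N+1) (i+1) := by
    intro i
    have r1 := R1 t ht (N+1) i
    rw [add_sub_cancel_right] at r1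
    have e1 := hre1 (t/q) _ _ htq (hx N) (hy (i+1))
    have e2 := hre2 (t/q) _ _ htq (hx N) (hy i)
    have e4 := hre4 (t/q) _ _ htq (hx N) (hy (i+1))
    rw [hqt] at e1 e2 e4
    have h1 : q ^ (-(N:ℤ)) * b1 / q = q ^ (-((N:ℤ)+1)) * b1 := by
      rw [show -((N:ℤ)+1) = -N - 1 by ring, zpow_sub_one₀ hq]; ring
    have h2 : q ^ (i+1) * b3 / q = q ^ i * b3 := by rw [pow_succ]; field_simp
    rw [h1] at e1
    rw [h2] at e4
    have h3 : q * q ^ (-((N:ℤ)+1)) = q ^ (-(N:ℤ)) := by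
      rw [show -((N:ℤ)+1) = -N - 1 by ring, zpow_sub_one₀ hq]; field_simp
    rw [← hyp] at e2
    simp only [hg, hΓs] at r1 ⊢
    linear_combination r1 - Γ i * e2
      + (t * b1 * (q ^ i * b3 - 1) * Γ i * ψ t (q ^ (-((N:ℤ)+1)) * b1) (q ^ (i+1) * b3)) * h3
      - (q ^ i * b3 - 1) * Γ i * (e4 - t * e1)
  set c : ℂ := q * t * b1 * q ^ (-((N:ℤ)+1)) with hc
  have hcne : c ≠ 0 := by
    have := zpow_ne_zero (-((N:ℤ)+1)) hq
    positivity
  have hqc : q * t * b1 * q ^ (-(N:ℤ)) = q * c := by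
    rw [hc, show -((N:ℤ)+1) = -N - 1 by ring, zpow_sub_one₀ hq]; field_simp
  have hcx : t * (1 - q ^ (-(N:ℤ)) * b1) = t - c := by
    have : q * (t * (1 - q ^ (-(N:ℤ)) * b1)) = q * (t - c) := by linear_combination -hqc
    exact mul_left_cancel₀ hq this
  set h : ℕ → ℂ := g t (N+1) with hh
  set G : ℕ → ℂ := g t N with hGd
  set Q : ℕ → ℂ := g (t/q) N with hQd
  have hG : ∀ i, G i = h i + c * h (i+1) := by
    intro i
    have r1 := R1 t ht (N+1) i
    rwa [add_sub_cancel_right] at r1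
  have hP : ∀ i, b3 * q ^ i * G i = Q i + Q (i+1) := by
    intro i
    have := R2 (t/q) htq N i
    rwa [hqt] at this
  have core := core_sum N q c t b3 hq hcne h G Q (cof N G) hG R3 hP (cof_orth N G)
  -- tau functions as Hankel determinants
  have key : ∀ (n r : ℕ) (m : ℤ) (s : ℂ), s ≠ 0 → (∏ i : Fin n, Γ (i + r)) * tauS q ψ n m r s b1 b3
      = kap q (q * s * b1 * q ^ m) n * Matrix.det (Matrix.of fun i k : Fin n => g s (n - 1 - m) (i + k + r)) := by
    intro n r m s hs
    rw [← hankelize q (q * s * b1) hq n r m (g s) (R1 s hs), tauS, tau, ← Matrix.det_mul_column]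
    congr 1
    ext i j
    simp only [Matrix.of_apply, hg]
    congr 2
    · rw [← mul_assoc, ← zpow_add₀ hq]; congr 2; ring
    · rw [← mul_assoc, ← zpow_add₀ hq, ← zpow_natCast]; push_cast; rfl
  set W : ℂ := ∏ i : Fin N, q ^ (i:ℕ) with hW
  have hW1 : ∏ i : Fin (N+1), q ^ (i:ℕ) = W * q ^ N := by
    rw [Fin.prod_univ_castSucc]; simp [hW]
  have hW2 : ∏ i : Fin N, q ^ ((i:ℕ)+1) = W * q ^ N := by
    simp only [pow_succ, Finset.prod_mul_distrib]; simp [hW]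
  set k1 := kap q (t * b1) N with hk1
  set k2 := kap q (t * b1) (N+1) with hk2
  have kN : kap q (q * t * b1) N = W * k1 := by rw [mul_assoc, kap_scale]
  have kN1 : kap q (q * t * b1) (N+1) = W * q ^ N * k2 := by rw [mul_assoc, kap_scale, hW1]
  set Rr : ℂ := ∏ i : Fin N, Γ (i + 1) with hR
  set R' : ℂ := ∏ i : Fin (N+1), Γ (i + 1) with hR'
  have hRne : Rr ≠ 0 := Finset.prod_ne_zero_iff.mpr fun i _ => hΓne _
  have hR'ne : R' ≠ 0 := Finset.prod_ne_zero_iff.mpr fun i _ => hΓne _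
  have hR2 : R' = (b3 - 1) * ∏ i : Fin N, Γ (i + 2) := by
    rw [hR', Fin.prod_univ_succ, ← hΓ1]; simp [add_assoc]
  have hR0 : ∏ i : Fin (N+1), Γ (i + 0) = Rr := by
    rw [Fin.prod_univ_succ]; simp [hΓ0, hR]
  have T1 := key N 1 (-1) (q * t) (mul_ne_zero hq ht)
  have T2 := key (N+1) 1 0 (t/q) htq
  have T3 := key N 1 0 t ht
  have T4 := key (N+1) 1 (-1) t ht
  have T5 := key N 2 (-1) t ht
  have T6 := key (N+1) 0 0 t ht
  rw [show q * (q * t) * b1 * q ^ (-1:ℤ) = q * t * b1 by rw [zpow_neg_one]; field_simp, kN,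
    show (N:ℤ) - 1 - -1 = N by ring] at T1
  rw [show q * (t / q) * b1 * q ^ (0:ℤ) = t * b1 by rw [zpow_zero]; field_simp,
    show ((N+1:ℕ):ℤ) - 1 - 0 = N by push_cast; ring] at T2
  rw [zpow_zero, mul_one, kN, sub_zero] at T3
  rw [show q * t * b1 * q ^ (-1:ℤ) = t * b1 by rw [zpow_neg_one]; field_simp,
    show ((N+1:ℕ):ℤ) - 1 - -1 = N + 1 by push_cast; ring] at T4
  rw [show q * t * b1 * q ^ (-1:ℤ) = t * b1 by rw [zpow_neg_one]; field_simp,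
    show (N:ℤ) - 1 - -1 = N by ring] at T5
  rw [zpow_zero, mul_one, kN1, show ((N+1:ℕ):ℤ) - 1 - 0 = N by push_cast; ring, hR0] at T6
  have D1 : W * (W * (q * b3) ^ N) * Matrix.det (Matrix.of fun i k : Fin N => g (q * t) N (i + k + 1))
      = ∑ k : Fin (N+1), cof N G k * (-1) ^ (k:ℕ) := by
    have := det_shift N G 1 one_ne_zero
    simp only [inv_one, one_pow, one_mul] at this
    rw [← this]
    have e : W * (q * b3) ^ N = ∏ i : Fin N, (q ^ (i:ℕ) * (q * b3)) := by
      rw [Finset.prod_mul_distrib]; simp [hW]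
    rw [e, hW, mul_assoc, ← Matrix.det_mul_column, ← Matrix.det_mul_row]
    congr 1
    ext i k
    simp only [Matrix.of_apply]
    rw [hGd, ← R2 t ht N (i+k+1)]
    ring
  have D2 := det_row N Q G (fun k => q⁻¹ ^ k * Q (k+1)) b3 (-1) (fun i => q ^ (i+1)) (fun k => q ^ k)
    (by intro k; rw [← mul_assoc, ← mul_pow, mul_inv_cancel₀ hq, one_pow, one_mul])
    (by
      intro i k
      have := hP (i + 1 + k)
      rw [show i + k + 1 = i + 1 + k by omega]
      rw [pow_add q (i+1) k] at this
      linear_combination -this)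
  simp only [hW1, hW2] at D2
  rw [det_bM] at D2
  have D3 : Matrix.det (Matrix.of fun i k : Fin N => g t (N - 1) (i + k + 1))
      = (q * c) ^ N * ∑ k : Fin (N+1), cof N G k * (-(q * c)⁻¹) ^ (k:ℕ) := by
    rw [← det_shift N G _ (mul_ne_zero hq hcne)]
    congr 1
    ext i k
    simp only [Matrix.of_apply]
    rw [R1 t ht, hqc]
  have D4 := det_row N h G (fun k => h (k+1)) c⁻¹ (-c⁻¹) (fun i => 1) (fun k => 1)
    (by intro k; simp)
    (by
      intro i k
      rw [hG, show i + k + 1 = i + 1 + k by omega]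
      field_simp
      ring)
  rw [det_bM] at D4
  simp only [Finset.prod_const_one, one_mul, mul_one] at D4
  have D5 : Matrix.det (Matrix.of fun i k : Fin N => g t N (i + k + 2)) = cof N G 0 := by
    simp only [cof, Fin.val_zero, pow_zero, one_mul]
    congr 1
    ext i k
    simp only [Matrix.of_apply, Fin.zero_succAbove, Fin.val_succ]
    rw [show (i:ℕ) + 1 + (k + 1) = i + k + 2 by omega]
  have D6 : Matrix.det (Matrix.of fun i k : Fin (N+1) => g t N (i + k + 0))
      = ∑ k : Fin (N+1), cof N G k * G k := by
    rw [← det_bM]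
    congr 1
    ext i k
    refine Fin.cases ?_ (fun i => ?_) i <;> simp [bM, hGd]
  rw [D2] at T2
  rw [D3] at T3
  rw [D4] at T4
  rw [D5] at T5
  rw [D6] at T6
  rw [hcx]
  have hcN : (q * c) ^ N * c⁻¹ ^ N = q ^ N := by
    rw [← mul_pow]; congr 1; field_simp
  have hqb : (q * b3) ^ N = q ^ N * b3 ^ N := mul_pow _ _ _
  push_cast at T1 T2 T3 T4 T5 T6
  generalize tauS q ψ N (-1) 1 (q * t) b1 b3 = τ1 at *
  generalize tauS q ψ (N+1) 0 1 (t / q) b1 b3 = τ2 at *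
  generalize tauS q ψ N 0 1 t b1 b3 = τ3 at *
  generalize tauS q ψ (N+1) (-1) 1 t b1 b3 = τ4 at *
  generalize tauS q ψ N (-1) 2 t b1 b3 = τ5 at *
  generalize tauS q ψ (N+1) 0 0 t b1 b3 = τ6 at *
  generalize (∑ k : Fin (N+1), cof N G k * (-1) ^ (k:ℕ)) = l1 at *
  generalize (∑ k : Fin (N+1), cof N G k * (q⁻¹ ^ (k:ℕ) * Q (k+1))) = DD at *
  generalize (∑ k : Fin (N+1), cof N G k * (-(q * c)⁻¹) ^ (k:ℕ)) = l3 at *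
  generalize (∑ k : Fin (N+1), cof N G k * h (k+1)) = F at *
  generalize (∑ k : Fin (N+1), cof N G k * G k) = A at *
  generalize cof N G 0 = l0 at *
  generalize Matrix.det (Matrix.of fun i k : Fin N => g (q * t) N (i + k + 1)) = d1 at *
  generalize (∏ i : Fin N, Γ (i + 2)) = R2' at *
  have p12 : (Rr * τ1) * (R' * τ2) = W * k1 * k2 * q ^ N * (l1 * DD) := by
    rw [T1, T2, ← D1, hqb]; ring
  have p34 : (Rr * τ3) * (R' * τ4) = W * k1 * k2 * q ^ N * (l3 * F) := by
    rw [T3, T4, ← hcN]; ring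
  have p56 : (R' * τ5) * (Rr * τ6) = W * k1 * k2 * q ^ N * ((b3 - 1) * l0 * A) := by
    rw [hR2, mul_assoc (b3 - 1), T5, T6]; ring
  have fin : Rr * R' * (τ1 * τ2 + (t - c) * τ3 * τ4 - τ5 * τ6) = 0 := by
    linear_combination p12 + (t - c) * p34 - p56 + W * k1 * k2 * q ^ N * core
  exact (mul_eq_zero.mp fin).resolve_left (mul_ne_zero hRne hR'ne)
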